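/- If M ≺ H_θ is an ℵ₀-guessing model, then both κ_M and M ∩ κ_M are strongly inaccessible cardinals. -/

import Mathlib

open Cardinal

namespace GuessingModels

/-- First-order formulas in the language of set theory (membership and equality),
with `n` free variables. -/
inductive SF : ℕ → Type
  | mem {n} (i j : Fin n) : SF n
  | eq {n} (i j : Fin n) : SF n
  | imp {n} (f g : SF n) : SF n
  | not {n} (f : SF n) : SF n
  | ex {n} (f : SF (n + 1)) : SF n

/-- Tarskian satisfaction of a set-theoretic formula in the structure `⟨S, ∈⟩`,
where `S` is a class of ZF sets. -/
def Realize (S : Set ZFSet) : ∀ {n}, SF n → (Fin n → ZFSet) → Prop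
  | _, .mem i j, v => v i ∈ v j
  | _, .eq i j, v => v i = v j
  | _, .imp f g, v => Realize S f v → Realize S g v
  | _, .not f, v => ¬ Realize S f v
  | _, .ex f, v => ∃ x ∈ S, Realize S f (Fin.cons x v)

/-- `M ≺ R` : `M` is an elementary substructure of `⟨R, ∈⟩`. -/
def Prec (M R : Set ZFSet) : Prop :=
  M ⊆ R ∧ ∀ {n : ℕ} (φ : SF n) (v : Fin n → ZFSet), (∀ i, v i ∈ M) →
    (Realize M φ v ↔ Realize R φ v)

/-- A (von Neumann) ordinal: a transitive set of transitive sets. -/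
def IsOrd (x : ZFSet) : Prop :=
  x.IsTransitive ∧ ∀ y ∈ x, ZFSet.IsTransitive y

/-- `≤` on ordinals, i.e. `∈` or `=`. -/
def ole (a b : ZFSet) : Prop := a ∈ b ∨ a = b

/-- The cardinality of (the extension of) a ZF set. -/
noncomputable def card (x : ZFSet) : Cardinal := Cardinal.mk x.toSet

/-- A ZF set which is a cardinal: an ordinal not equinumerous with any of its members. -/
def IsCard (κ : ZFSet) : Prop := IsOrd κ ∧ ∀ β ∈ κ, card β < card κ

/-- `s` (an external class) is a cofinal subset of the ordinal `κ`. -/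
def CofinalSetIn (s : Set ZFSet) (κ : ZFSet) : Prop :=
  (∀ x ∈ s, x ∈ κ) ∧ ∀ β ∈ κ, ∃ γ ∈ s, ole β γ

/-- A regular cardinal: an infinite cardinal all of whose cofinal subsets have full size. -/
def IsRegCard (κ : ZFSet) : Prop :=
  IsCard κ ∧ ZFSet.omega ⊆ κ ∧
    ∀ s : Set ZFSet, CofinalSetIn s κ → Cardinal.mk s = card κ

/-- A strong limit ZF cardinal. -/
def IsStrongLimit (κ : ZFSet) : Prop := ∀ β ∈ κ, (2 : Cardinal) ^ card β < card κ

/-- A strongly inaccessible cardinal: regular, uncountable and strong limit. -/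
def IsInacc (κ : ZFSet) : Prop := IsRegCard κ ∧ ZFSet.omega ∈ κ ∧ IsStrongLimit κ

/-- The transitive closure of a ZF set, as a class. -/
def tcl (x : ZFSet) : Set ZFSet := {y | Relation.TransGen (· ∈ ·) y x}

/-- `H_θ` : the class of sets hereditarily of size `< θ`. -/
noncomputable def HSet (θ : ZFSet) : Set ZFSet := {x | Cardinal.mk (tcl x) < card θ}

/-- `V_α` as a class, for `α` an ordinal (as a ZF set): sets of rank `< α`. -/
noncomputable def VSet (α : ZFSet) : Set ZFSet := {x | x.rank < α.rank}

/-- A suitable initial segment: `H_θ` for a regular cardinal `θ`, or a rank initial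
segment `V_α`. -/
def Suitable (R : Set ZFSet) : Prop :=
  (∃ θ : ZFSet, IsRegCard θ ∧ R = HSet θ) ∨ (∃ α : ZFSet, IsOrd α ∧ R = VSet α)

/-- `κ = κ_M` : `κ` is the least ordinal in `M` with `M ∩ κ ≠ κ`. -/
def KappaSpec (M : Set ZFSet) (κ : ZFSet) : Prop :=
  IsOrd κ ∧ κ ∈ M ∧ (∃ β ∈ κ, β ∉ M) ∧
    ∀ α : ZFSet, IsOrd α → α ∈ M → (∃ β ∈ α, β ∉ M) → ole κ α

/-- `d` is `(δ, M)`-approximated: `d ∩ Z ∈ M` for every `Z ∈ M` of size `< δ`. -/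
noncomputable def Approx (M : Set ZFSet) (δ : Cardinal.{1}) (d : ZFSet) : Prop :=
  ∀ Z : ZFSet, Z ∈ M → card Z < δ → (d ∩ Z) ∈ M

/-- `d ⊆ X` is `M`-guessed: `d ∩ M = e ∩ M` for some `e ∈ M ∩ P(X)`. -/
def Guessed (M : Set ZFSet) (X d : ZFSet) : Prop :=
  ∃ e : ZFSet, e ∈ M ∧ e ⊆ X ∧ ∀ z ∈ M, (z ∈ e ↔ z ∈ d)

/-- `M` is a `δ`-guessing model: every `(δ,M)`-approximated subset of any `X ∈ M`
is `M`-guessed. -/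
noncomputable def GuessingModel (M : Set ZFSet) (δ : Cardinal.{1}) : Prop :=
  ∀ X ∈ M, ∀ d : ZFSet, d ⊆ X → Approx M δ d → Guessed M X d

/-- `M` is `ℵ₁`-internally unbounded: every countable subset of `M` is contained
in a countable element of `M`. -/
noncomputable def IntUnb (M : Set ZFSet) : Prop :=
  ∀ A : Set ZFSet, A ⊆ M → A.Countable → ∃ z ∈ M, card z ≤ ℵ₀ ∧ A ⊆ z.toSet

/-! ### Definable predicates over a class -/

/-- `P` is first-order definable over `⟨H, ∈⟩`, without parameters. -/
def Def (H : Set ZFSet) {n : ℕ} (P : (Fin n → ZFSet) → Prop) : Prop :=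
  ∃ φ : SF n, ∀ v : Fin n → ZFSet, (∀ i, v i ∈ H) → (Realize H φ v ↔ P v)

namespace Def

variable {H : Set ZFSet} {n : ℕ}

theorem congr {P Q : (Fin n → ZFSet) → Prop} (hP : Def H P) (h : ∀ v, P v ↔ Q v) : Def H Q := by
  obtain ⟨φ, hφ⟩ := hP
  exact ⟨φ, fun v hv => (hφ v hv).trans (h v)⟩

theorem mem (i j : Fin n) : Def H (fun v => v i ∈ v j) := ⟨.mem i j, fun _ _ => Iff.rfl⟩

theorem eq (i j : Fin n) : Def H (fun v => v i = v j) := ⟨.eq i j, fun _ _ => Iff.rfl⟩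

theorem not {P : (Fin n → ZFSet) → Prop} (hP : Def H P) : Def H (fun v => ¬ P v) := by
  obtain ⟨φ, hφ⟩ := hP
  exact ⟨.not φ, fun v hv => not_congr (hφ v hv)⟩

theorem imp {P Q : (Fin n → ZFSet) → Prop} (hP : Def H P) (hQ : Def H Q) :
    Def H (fun v => P v → Q v) := by
  obtain ⟨φ, hφ⟩ := hP
  obtain ⟨ψ, hψ⟩ := hQ
  exact ⟨.imp φ ψ, fun v hv => imp_congr (hφ v hv) (hψ v hv)⟩

theorem and {P Q : (Fin n → ZFSet) → Prop} (hP : Def H P) (hQ : Def H Q) :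
    Def H (fun v => P v ∧ Q v) :=
  (hP.imp hQ.not).not.congr fun v => by tauto

theorem or {P Q : (Fin n → ZFSet) → Prop} (hP : Def H P) (hQ : Def H Q) :
    Def H (fun v => P v ∨ Q v) :=
  (hP.not.imp hQ).congr fun v => by tauto

theorem iff {P Q : (Fin n → ZFSet) → Prop} (hP : Def H P) (hQ : Def H Q) :
    Def H (fun v => P v ↔ Q v) :=
  ((hP.imp hQ).and (hQ.imp hP)).congr fun v => by tauto

theorem ex {P : ZFSet → (Fin n → ZFSet) → Prop}
    (hP : Def H (fun w : Fin (n + 1) → ZFSet => P (w 0) (Fin.tail w))) :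
    Def H (fun v => ∃ x ∈ H, P x v) := by
  obtain ⟨φ, hφ⟩ := hP
  refine ⟨.ex φ, fun v hv => exists_congr fun x => and_congr_right fun hx => ?_⟩
  refine (hφ (Fin.cons x v) (Fin.cases hx hv)).trans ?_
  simp

theorem all {P : ZFSet → (Fin n → ZFSet) → Prop}
    (hP : Def H (fun w : Fin (n + 1) → ZFSet => P (w 0) (Fin.tail w))) :
    Def H (fun v => ∀ x ∈ H, P x v) :=
  (Def.ex (P := fun x v => ¬ P x v) hP.not).not.congr fun v => by
    simp

theorem exMem (hH : ∀ y ∈ H, ∀ x ∈ y, x ∈ H) (i : Fin n) {P : ZFSet → (Fin n → ZFSet) → Prop}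
    (hP : Def H (fun w : Fin (n + 1) → ZFSet => P (w 0) (Fin.tail w))) :
    Def H (fun v => ∃ x ∈ v i, P x v) := by
  obtain ⟨φ, hφ⟩ := Def.ex (P := fun x v => x ∈ v i ∧ P x v) (Def.and (Def.mem 0 i.succ) hP)
  refine ⟨φ, fun v hv => (hφ v hv).trans ?_⟩
  exact ⟨fun ⟨x, _, h⟩ => ⟨x, h⟩, fun ⟨x, h, h'⟩ => ⟨x, hH _ (hv i) x h, h, h'⟩⟩

theorem allMem (hH : ∀ y ∈ H, ∀ x ∈ y, x ∈ H) (i : Fin n) {P : ZFSet → (Fin n → ZFSet) → Prop}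
    (hP : Def H (fun w : Fin (n + 1) → ZFSet => P (w 0) (Fin.tail w))) :
    Def H (fun v => ∀ x ∈ v i, P x v) :=
  (Def.exMem hH i (P := fun x v => ¬ P x v) hP.not).not.congr fun v => by simp

theorem subset (hH : ∀ y ∈ H, ∀ x ∈ y, x ∈ H) (i j : Fin n) : Def H (fun v => v i ⊆ v j) :=
  (Def.allMem hH i (P := fun x v => x ∈ v j) (Def.mem 0 j.succ)).congr fun _ => Iff.rfl

theorem eqEmpty (hH : ∀ y ∈ H, ∀ x ∈ y, x ∈ H) (i : Fin n) : Def H (fun v => v i = ∅) :=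
  (Def.allMem hH i (P := fun x _ => ¬ x = x) (Def.eq 0 0).not).congr fun v => by
    simp [ZFSet.eq_empty]

theorem eqInsert (hH : ∀ y ∈ H, ∀ x ∈ y, x ∈ H) (i j k : Fin n) :
    Def H (fun v => v i = insert (v j) (v k)) :=
  (((Def.mem j i).and (Def.subset hH k i)).and
    (Def.allMem hH i (P := fun x v => x = v j ∨ x ∈ v k)
      ((Def.eq 0 j.succ).or (Def.mem 0 k.succ)))).congr fun v => by
    constructor
    · rintro ⟨⟨h₁, h₂⟩, h₃⟩
      ext z
      rw [ZFSet.mem_insert_iff]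
      exact ⟨h₃ z, fun h => h.elim (fun h => h ▸ h₁) fun h => h₂ h⟩
    · intro h
      simp only [h, ZFSet.mem_insert_iff, true_or, true_and]
      exact ⟨fun z hz => ZFSet.mem_insert_iff.2 (Or.inr hz), fun x hx => hx⟩

theorem eqUnordered (hH : ∀ y ∈ H, ∀ x ∈ y, x ∈ H) (i j k : Fin n) :
    Def H (fun v => v i = {v j, v k}) :=
  (((Def.mem j i).and (Def.mem k i)).and
    (Def.allMem hH i (P := fun x v => x = v j ∨ x = v k)
      ((Def.eq 0 j.succ).or (Def.eq 0 k.succ)))).congr fun v => by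
    constructor
    · rintro ⟨⟨h₁, h₂⟩, h₃⟩
      ext z
      rw [ZFSet.mem_pair]
      exact ⟨h₃ z, fun h => h.elim (fun h => h ▸ h₁) fun h => h ▸ h₂⟩
    · intro h
      simp [h]

theorem eqPair (hH : ∀ y ∈ H, ∀ x ∈ y, x ∈ H) (i j k : Fin n) :
    Def H (fun v => v i = ZFSet.pair (v j) (v k)) :=
  (Def.exMem hH i (P := fun a v => a = {v j, v j} ∧ ∃ b ∈ v i, b = {v j, v k} ∧ v i = {a, b})
    ((Def.eqUnordered hH 0 j.succ j.succ).and
      (Def.exMem hH i.succ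
        (P := fun b w => b = {w j.succ, w k.succ} ∧ w i.succ = {w 0, b})
        ((Def.eqUnordered hH 0 j.succ.succ k.succ.succ).and
          (Def.eqUnordered hH i.succ.succ 1 0))))).congr fun v => by
    have h : ({v j, v j} : ZFSet) = {v j} := by ext; simp
    simp only [h]
    constructor
    · rintro ⟨a, _, rfl, b, _, rfl, h⟩
      exact h
    · intro h
      rw [h]
      exact ⟨_, by simp [ZFSet.pair], rfl, _, by simp [ZFSet.pair], rfl, rfl⟩

theorem rel (hH : ∀ y ∈ H, ∀ x ∈ y, x ∈ H) (i j k : Fin n) :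
    Def H (fun v => ZFSet.pair (v j) (v k) ∈ v i) :=
  (Def.exMem hH i (P := fun p v => p = ZFSet.pair (v j) (v k))
    (Def.eqPair hH 0 j.succ k.succ)).congr fun v => by simp

end Def

/-- The Tarski–Vaught criterion, for an elementary substructure. -/
theorem Prec.exists_mem {M H : Set ZFSet} (hM : Prec M H) {n : ℕ}
    {P : (Fin (n + 1) → ZFSet) → Prop} (hP : Def H P) (v : Fin n → ZFSet) (hv : ∀ i, v i ∈ M)
    (h : ∃ x ∈ H, P (Fin.cons x v)) : ∃ x ∈ M, P (Fin.cons x v) := by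
  obtain ⟨φ, hφ⟩ := hP
  obtain ⟨x, hx, hPx⟩ := h
  have h₁ : Realize H (.ex φ) v :=
    ⟨x, hx, (hφ _ (Fin.cases hx fun i => hM.1 (hv i))).2 hPx⟩
  obtain ⟨y, hy, hPy⟩ := (hM.2 (.ex φ) v hv).2 h₁
  have hyv : ∀ i, (Fin.cons y v : Fin (n + 1) → ZFSet) i ∈ M := Fin.cases hy hv
  exact ⟨y, hy, (hφ _ fun i => hM.1 (hyv i)).1 ((hM.2 φ _ hyv).1 hPy)⟩

/-! ### Closure properties of `H_θ` -/

theorem mem_toSet {x y : ZFSet} : x ∈ y.toSet ↔ x ∈ y := Iff.rfl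

theorem tcl_subset {x : ZFSet} {T : Set ZFSet} (hx : ∀ y ∈ x, y ∈ T)
    (hT : ∀ y ∈ T, ∀ z ∈ y, z ∈ T) : tcl x ⊆ T := by
  intro y hy
  induction hy using Relation.TransGen.head_induction_on with
  | single h => exact hx _ h
  | head h _ ih => exact hT _ ih _ h

theorem mem_tcl_of_mem {x y : ZFSet} (h : y ∈ x) : y ∈ tcl x := Relation.TransGen.single h

theorem mem_tcl_trans {x y z : ZFSet} (hy : y ∈ tcl x) (h : z ∈ y) : z ∈ tcl x :=
  Relation.TransGen.head h hy

theorem mk_ofNat_injective : Function.Injective fun n : ℕ => ZFSet.mk (PSet.ofNat n) := by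
  have hlt : ∀ m n : ℕ, m < n → ZFSet.mk (PSet.ofNat m) ∈ ZFSet.mk (PSet.ofNat n) := by
    intro m n h
    induction h with
    | refl => exact PSet.mem_insert _ _
    | step _ ih => exact PSet.mem_insert_of_mem _ ih
  intro m n h
  rcases lt_trichotomy m n with h' | h' | h'
  · exact (ZFSet.mem_irrefl _
      (Eq.subst (motive := fun x => x ∈ ZFSet.mk (PSet.ofNat n)) h (hlt _ _ h'))).elim
  · exact h'
  · exact (ZFSet.mem_irrefl _
      (Eq.subst (motive := fun x => ZFSet.mk (PSet.ofNat n) ∈ x) h (hlt _ _ h'))).elim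

theorem mem_omega {x : ZFSet} : x ∈ ZFSet.omega ↔ ∃ n : ℕ, x = ZFSet.mk (PSet.ofNat n) := by
  induction x using Quotient.inductionOn with
  | h p =>
    constructor
    · rintro ⟨⟨n⟩, h⟩
      exact ⟨n, ZFSet.sound h⟩
    · rintro ⟨n, h⟩
      exact ⟨⟨n⟩, ZFSet.exact h⟩

theorem omega_induction {p : ZFSet → Prop} (h₀ : p ∅) (h₁ : ∀ n ∈ ZFSet.omega, p n → p (insert n n))
    {x : ZFSet} (hx : x ∈ ZFSet.omega) : p x := by
  obtain ⟨n, rfl⟩ := mem_omega.1 hx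
  clear hx
  induction n with
  | zero => exact h₀
  | succ n ih => exact h₁ _ (mem_omega.2 ⟨n, rfl⟩) ih

theorem aleph0_le_card {θ : ZFSet} (h : ZFSet.omega ⊆ θ) : ℵ₀ ≤ card θ := by
  rw [card, Cardinal.aleph0_le_mk_iff]
  exact Infinite.of_injective
    (fun n : ℕ => (⟨_, h (mem_omega.2 ⟨n, rfl⟩)⟩ : θ.toSet))
    fun m n hmn => mk_ofNat_injective (congrArg Subtype.val hmn)

theorem card_mono {x y : ZFSet} (h : x ⊆ y) : card x ≤ card y :=
  Cardinal.mk_le_mk_of_subset fun _ hz => h hz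

theorem HSet.mem {θ x y : ZFSet} (hy : y ∈ HSet θ) (hx : x ∈ y) : x ∈ HSet θ :=
  (Cardinal.mk_le_mk_of_subset (tcl_subset (fun _ hz => mem_tcl_trans (mem_tcl_of_mem hx) hz)
    fun _ h _ => mem_tcl_trans h)).trans_lt hy

theorem HSet.subset {θ x y : ZFSet} (hy : y ∈ HSet θ) (hx : x ⊆ y) : x ∈ HSet θ :=
  (Cardinal.mk_le_mk_of_subset (tcl_subset (fun _ hz => mem_tcl_of_mem (hx hz))
    fun _ h _ => mem_tcl_trans h)).trans_lt hy

theorem HSet.insert {θ x y : ZFSet} (hθ : ℵ₀ ≤ card θ) (hx : x ∈ HSet θ) (hy : y ∈ HSet θ) :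
    insert x y ∈ HSet θ := by
  have h : tcl (Insert.insert x y) ⊆ Insert.insert x (tcl x ∪ tcl y) := by
    refine tcl_subset ?_ ?_
    · intro z hz
      rcases ZFSet.mem_insert_iff.1 hz with rfl | hz
      · exact Or.inl rfl
      · exact Or.inr (Or.inr (mem_tcl_of_mem hz))
    · rintro z (rfl | hz | hz) w hw
      · exact Or.inr (Or.inl (mem_tcl_of_mem hw))
      · exact Or.inr (Or.inl (mem_tcl_trans hz hw))
      · exact Or.inr (Or.inr (mem_tcl_trans hz hw))
  refine ((Cardinal.mk_le_mk_of_subset h).trans Cardinal.mk_insert_le).trans_lt ?_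
  refine Cardinal.add_lt_of_lt hθ ((Cardinal.mk_union_le _ _).trans_lt
    (Cardinal.add_lt_of_lt hθ hx hy)) (Cardinal.one_lt_aleph0.trans_le hθ)

theorem HSet.empty {θ : ZFSet} (hθ : ℵ₀ ≤ card θ) : ∅ ∈ HSet θ := by
  have h : tcl ∅ ⊆ ∅ := tcl_subset (by simp) (by simp)
  exact ((Cardinal.mk_le_mk_of_subset h).trans_eq (by simp)).trans_lt
    (Cardinal.aleph0_pos.trans_le hθ)

theorem HSet.card_lt {θ x : ZFSet} (hx : x ∈ HSet θ) : card x < card θ :=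
  (Cardinal.mk_le_mk_of_subset fun _ hz => mem_tcl_of_mem hz).trans_lt hx

theorem HSet.prod {θ κ : ZFSet} (hθ : ℵ₀ ≤ card θ) (hκ : κ ∈ HSet θ) (hord : IsOrd κ) :
    κ.prod κ ∈ HSet θ := by
  have h : tcl (κ.prod κ) ⊆ (κ.toSet ∪
      Set.range fun p : κ.toSet × κ.toSet => ({p.1.1, p.2.1} : ZFSet)) ∪
      Set.range fun p : κ.toSet × κ.toSet => ZFSet.pair p.1.1 p.2.1 := by
    refine tcl_subset ?_ ?_
    · intro z hz
      obtain ⟨a, ha, b, hb, rfl⟩ := ZFSet.mem_prod.1 hz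
      exact Or.inr ⟨(⟨a, ha⟩, ⟨b, hb⟩), rfl⟩
    · rintro z ((hz | ⟨⟨⟨a, ha⟩, b, hb⟩, rfl⟩) | ⟨⟨⟨a, ha⟩, b, hb⟩, rfl⟩) w hw
      · exact Or.inl (Or.inl (hord.1 z hz hw))
      · rcases ZFSet.mem_pair.1 hw with rfl | rfl
        · exact Or.inl (Or.inl ha)
        · exact Or.inl (Or.inl hb)
      · rcases ZFSet.mem_pair.1 hw with rfl | rfl
        · exact Or.inl (Or.inr ⟨(⟨a, ha⟩, ⟨a, ha⟩), by ext; simp⟩)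
        · exact Or.inl (Or.inr ⟨(⟨a, ha⟩, ⟨b, hb⟩), rfl⟩)
  have hκ' := HSet.card_lt hκ
  have hprod : Cardinal.mk (κ.toSet × κ.toSet) < card θ := by
    rw [Cardinal.mk_prod, Cardinal.lift_id]
    exact Cardinal.mul_lt_of_lt hθ hκ' hκ'
  refine ((Cardinal.mk_le_mk_of_subset h).trans (Cardinal.mk_union_le _ _)).trans_lt ?_
  exact Cardinal.add_lt_of_lt hθ ((Cardinal.mk_union_le _ _).trans_lt
    (Cardinal.add_lt_of_lt hθ hκ' (Cardinal.mk_range_le.trans_lt hprod)))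
    (Cardinal.mk_range_le.trans_lt hprod)

theorem HSet.exists_rel {θ κ : ZFSet} (hθ : ℵ₀ ≤ card θ) (hκ : κ ∈ HSet θ) (hord : IsOrd κ)
    (r : ZFSet → ZFSet → Prop) :
    ∃ R ∈ HSet θ, ∀ x ∈ κ, ∀ y ∈ κ, (ZFSet.pair x y ∈ R ↔ r x y) := by
  refine ⟨(κ.prod κ).sep fun p => ∃ x y, p = ZFSet.pair x y ∧ r x y,
    HSet.subset (HSet.prod hθ hκ hord) (ZFSet.sep_subset), fun x hx y hy => ?_⟩
  rw [ZFSet.mem_sep, ZFSet.pair_mem_prod]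
  constructor
  · rintro ⟨_, x', y', h, hr⟩
    obtain ⟨rfl, rfl⟩ := ZFSet.pair_injective h
    exact hr
  · exact fun hr => ⟨⟨hx, hy⟩, x, y, rfl, hr⟩

/-! ### Ordinals -/

theorem IsOrd.isOrdinal {x : ZFSet} (h : IsOrd x) : x.IsOrdinal :=
  ZFSet.isOrdinal_iff_forall_mem_isTransitive.2 h

theorem IsOrd.mem {x y : ZFSet} (h : IsOrd x) (hy : y ∈ x) : IsOrd y :=
  ⟨h.2 y hy, fun z hz => h.2 z (h.1 y hy hz)⟩

theorem isOrd_omega : IsOrd ZFSet.omega := by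
  have h : ∀ x ∈ ZFSet.omega, x.IsTransitive ∧ x ⊆ ZFSet.omega := fun x hx =>
    omega_induction (p := fun x => x.IsTransitive ∧ x ⊆ ZFSet.omega)
      ⟨ZFSet.isTransitive_empty, ZFSet.empty_subset _⟩
      (fun n hn ih => by
        refine ⟨fun y hy z hz => ?_, fun y hy => ?_⟩
        · rcases ZFSet.mem_insert_iff.1 hy with rfl | hy
          · exact ZFSet.mem_insert_iff.2 (Or.inr hz)
          · exact ZFSet.mem_insert_iff.2 (Or.inr (ih.1 y hy hz))
        · rcases ZFSet.mem_insert_iff.1 hy with rfl | hy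
          · exact hn
          · exact ih.2 hy) hx
  exact ⟨fun x hx => (h x hx).2, fun x hx => (h x hx).1⟩

/-- Every cardinal below the cardinality of an ordinal is the cardinality of one of its members. -/
theorem IsOrd.exists_card_eq {κ : ZFSet} (h : IsOrd κ) {c : Cardinal} (hc : c < card κ) :
    ∃ β ∈ κ, card β = c := by
  let r : κ.toSet → κ.toSet → Prop := fun x y => x.1 ∈ y.1
  have : IsWellFounded κ.toSet r := ⟨InvImage.wf Subtype.val ZFSet.mem_wf⟩
  have : Std.Trichotomous r := h.isOrdinal.trichotomous
  have : IsTrans κ.toSet r := h.isOrdinal.isTrans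
  have : IsWellOrder κ.toSet r := {}
  have hc' : c.ord < Ordinal.type r :=
    (Cardinal.ord_lt_ord.2 hc).trans_le (Cardinal.ord_le_type r)
  obtain ⟨β, hβ⟩ := Ordinal.typein_surj r hc'
  refine ⟨β.1, β.2, ?_⟩
  have h₁ := Ordinal.card_typein (r := r) β
  rw [hβ, Cardinal.card_ord] at h₁
  rw [h₁]
  exact Cardinal.mk_congr
    { toFun := fun y => ⟨⟨y.1, h.1 _ β.2 y.2⟩, y.2⟩
      invFun := fun y => ⟨y.1.1, y.2⟩
      left_inv := fun _ => rfl
      right_inv := fun _ => rfl }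

/-! ### Finite sets in elementary substructures -/

section Elementary

variable {θ : ZFSet} {M : Set ZFSet}

theorem HSet.transitive (θ : ZFSet) : ∀ y ∈ HSet θ, ∀ x ∈ y, x ∈ HSet θ :=
  fun _ hy _ hx => HSet.mem hy hx

theorem empty_mem (hθ : ℵ₀ ≤ card θ) (hM : Prec M (HSet θ)) : ∅ ∈ M := by
  obtain ⟨x, hx, h⟩ := hM.exists_mem (Def.eqEmpty (HSet.transitive θ) 0) ![] (by simp)
    ⟨∅, HSet.empty hθ, rfl⟩
  exact (show x = ∅ from h) ▸ hx

theorem insert_mem (hθ : ℵ₀ ≤ card θ) (hM : Prec M (HSet θ)) {x y : ZFSet} (hx : x ∈ M)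
    (hy : y ∈ M) : insert x y ∈ M := by
  obtain ⟨z, hz, h⟩ := hM.exists_mem (Def.eqInsert (HSet.transitive θ) 0 1 2) ![x, y]
    (by simp [Fin.forall_fin_two, hx, hy]) ⟨_, HSet.insert hθ (hM.1 hx) (hM.1 hy), rfl⟩
  exact (show z = insert x y from h) ▸ hz

theorem mem_of_finite_subset (hθ : ℵ₀ ≤ card θ) (hM : Prec M (HSet θ)) {z : ZFSet}
    (hz : z.toSet.Finite) (hzM : z.toSet ⊆ M) : z ∈ M := by
  have key : ∀ s : Set ZFSet, s.Finite → s ⊆ M → ∃ y ∈ M, y.toSet = s := by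
    intro s hs
    induction s, hs using Set.Finite.induction_on with
    | empty => exact fun _ => ⟨∅, empty_mem hθ hM, by ext; simp [mem_toSet]⟩
    | @insert a s _ _ ih =>
      intro h
      obtain ⟨y, hy, rfl⟩ := ih fun x hx => h (Or.inr hx)
      exact ⟨_, insert_mem hθ hM (h (Or.inl rfl)) hy, by ext; simp [mem_toSet]⟩
  obtain ⟨y, hy, h⟩ := key _ hz hzM
  have : y = z := by
    ext x
    rw [← mem_toSet, h, mem_toSet]
  exact this ▸ hy

theorem subset_of_finite (hM : Prec M (HSet θ)) {z : ZFSet} (hz : z.toSet.Finite) (hzM : z ∈ M) :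
    z.toSet ⊆ M := by
  induction hn : z.toSet.ncard generalizing z with
  | zero =>
    rw [Set.ncard_eq_zero hz] at hn
    rw [hn]
    exact Set.empty_subset _
  | succ n ih =>
    have hne : z.toSet.Nonempty := by
      rw [← Set.ncard_pos hz]
      omega
    obtain ⟨a, ha⟩ := hne
    obtain ⟨x, hx, hxz⟩ := hM.exists_mem (Def.mem 0 1) ![z] (by simp [hzM])
      ⟨a, HSet.mem (hM.1 hzM) ha, ha⟩
    replace hxz : x ∈ z := hxz
    have hsep : z = insert x (z \ {x}) := by
      ext w
      by_cases h : w = x <;> simp [h, hxz]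
    obtain ⟨y, hy, hyz⟩ := hM.exists_mem
      ((Def.eqInsert (HSet.transitive θ) 1 2 0).and (Def.mem 2 0).not) ![z, x]
      (by simp [Fin.forall_fin_two, hx, hzM])
      ⟨z \ {x}, HSet.subset (hM.1 hzM) (fun w hw => (ZFSet.mem_sdiff.1 hw).1), hsep,
        fun h => (ZFSet.mem_sdiff.1 (show x ∈ z \ {x} from h)).2 (ZFSet.mem_singleton.2 rfl)⟩
    obtain ⟨rfl, hxy⟩ : z = insert x y ∧ x ∉ y := hyz
    have hset : (insert x y : ZFSet).toSet = insert x y.toSet := by ext; simp [mem_toSet]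
    rw [hset] at hz hn ⊢
    have hyf : y.toSet.Finite := hz.subset (Set.subset_insert _ _)
    rw [Set.ncard_insert_of_notMem (show x ∉ y.toSet from hxy) hyf] at hn
    exact Set.insert_subset hx (ih hyf hy (by omega))

/-- Over an elementary substructure of `H_θ`, every set is `ℵ₀`-approximated, so an
`ℵ₀`-guessing model guesses every subset of each of its elements. -/
theorem GuessingModel.guessed {M : Set ZFSet.{0}} {θ : ZFSet}
    (hθ : ℵ₀ ≤ card θ) (hM : Prec M (HSet θ)) (hG : GuessingModel M ℵ₀) {X d : ZFSet} (hX : X ∈ M)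
    (hd : d ⊆ X) : Guessed M X d := by
  refine hG X hX d hd fun Z hZ hfin => ?_
  have hZf : Z.toSet.Finite := Cardinal.lt_aleph0_iff_set_finite.1 hfin
  exact mem_of_finite_subset hθ hM (hZf.subset fun x hx => (ZFSet.mem_inter.1 hx).2)
    fun x hx => subset_of_finite hM hZf hZ (ZFSet.mem_inter.1 hx).2

theorem omega_subset (hθ : ℵ₀ ≤ card θ) (hM : Prec M (HSet θ)) {n : ZFSet}
    (hn : n ∈ ZFSet.omega) : n ∈ M :=
  omega_induction (p := (· ∈ M)) (empty_mem hθ hM) (fun _ _ h => insert_mem hθ hM h h) hn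

theorem omega_mem (hM : Prec M (HSet θ)) (hω : ZFSet.omega ∈ HSet θ) : ZFSet.omega ∈ M := by
  let Inductive : ZFSet → Prop := fun w =>
    (∃ x ∈ w, x = ∅) ∧ ∀ x ∈ w, ∃ y ∈ w, y = insert x x
  have hdef : ∀ {n : ℕ} (i : Fin n), Def (HSet θ) (fun v => Inductive (v i)) := fun i =>
    (Def.exMem (HSet.transitive θ) i (P := fun x _ => x = ∅)
      (Def.eqEmpty (HSet.transitive θ) 0)).and
    (Def.allMem (HSet.transitive θ) i (P := fun x v => ∃ y ∈ v i, y = insert x x)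
      (Def.exMem (HSet.transitive θ) i.succ (P := fun y w => y = insert (w 0) (w 0))
        (Def.eqInsert (HSet.transitive θ) 0 1 1)))
  have hind : Inductive ZFSet.omega :=
    ⟨⟨_, ZFSet.omega_zero, rfl⟩, fun x hx => ⟨_, ZFSet.omega_succ hx, rfl⟩⟩
  have hleast : ∀ w, Inductive w → ZFSet.omega ⊆ w := by
    rintro w ⟨⟨_, h₀, rfl⟩, h₁⟩ x hx
    refine omega_induction (p := (· ∈ w)) h₀ (fun n _ hn => ?_) hx
    obtain ⟨_, hy, rfl⟩ := h₁ n hn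
    exact hy
  obtain ⟨w, hw, h⟩ := hM.exists_mem ((hdef 0).and
    (Def.all (P := fun w' v => Inductive w' → v 0 ⊆ w')
      ((hdef 0).imp (Def.subset (HSet.transitive θ) 1 0)))) ![] (by simp)
    ⟨ZFSet.omega, hω, hind, fun w' _ => hleast w'⟩
  obtain ⟨h₁, h₂⟩ : Inductive w ∧ ∀ w' ∈ HSet θ, Inductive w' → w ⊆ w' := h
  have : w = ZFSet.omega := ZFSet.ext fun x => ⟨fun hx => h₂ _ hω hind hx, fun hx => hleast w h₁ hx⟩
  exact this ▸ hw

end Elementary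

/-! ### Definable properties of relations coded by sets of ordered pairs -/

/-- `R` is a partial function from `β` to `κ` with cofinal range. -/
def CofinalRel (R β κ : ZFSet) : Prop :=
  (∀ ξ ∈ β, ∀ η ∈ κ, ∀ η' ∈ κ, ZFSet.pair ξ η ∈ R → ZFSet.pair ξ η' ∈ R → η = η') ∧
    ∀ α ∈ κ, ∃ ξ ∈ β, ∃ η ∈ κ, ZFSet.pair ξ η ∈ R ∧ (α ∈ η ∨ α = η)

/-- The sections `{ξ ∈ β | (a, ξ) ∈ R}` are distinct for distinct `a ∈ κ`. -/
def SeparatingRel (R κ β : ZFSet) : Prop :=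
  ∀ a ∈ κ, ∀ b ∈ κ, (∀ ξ ∈ β, ZFSet.pair a ξ ∈ R ↔ ZFSet.pair b ξ ∈ R) → a = b

/-- Every subset of `β` in `H` is a section `{ξ ∈ β | (δ, ξ) ∈ R}` for some `δ ∈ γ`. -/
def CodesPowerset (H : Set ZFSet) (R γ β : ZFSet) : Prop :=
  ∀ d ∈ H, d ⊆ β → ∃ δ ∈ γ, ∀ ξ ∈ β, ξ ∈ d ↔ ZFSet.pair δ ξ ∈ R

/-- `R` is a total relation from `γ` to `e` which is injective. -/
def InjectiveRel (R γ e : ZFSet) : Prop :=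
  (∀ δ ∈ γ, ∃ η ∈ e, ZFSet.pair δ η ∈ R) ∧
    ∀ δ ∈ γ, ∀ δ' ∈ γ, ∀ η ∈ e, ZFSet.pair δ η ∈ R → ZFSet.pair δ' η ∈ R → δ = δ'

section DefRel

variable {H : Set ZFSet} {n : ℕ}

theorem Def.cofinalRel (hH : ∀ y ∈ H, ∀ x ∈ y, x ∈ H) (i j k : Fin n) :
    Def H (fun v => CofinalRel (v i) (v j) (v k)) :=
  (Def.allMem hH j (P := fun ξ v => ∀ η ∈ v k, ∀ η' ∈ v k,
      ZFSet.pair ξ η ∈ v i → ZFSet.pair ξ η' ∈ v i → η = η')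
    (Def.allMem hH k.succ (P := fun η v => ∀ η' ∈ v k.succ,
      ZFSet.pair (v 0) η ∈ v i.succ → ZFSet.pair (v 0) η' ∈ v i.succ → η = η')
    (Def.allMem hH k.succ.succ (P := fun η' v =>
      ZFSet.pair (v 1) (v 0) ∈ v i.succ.succ → ZFSet.pair (v 1) η' ∈ v i.succ.succ → v 0 = η')
    ((Def.rel hH i.succ.succ.succ 2 1).imp
      ((Def.rel hH i.succ.succ.succ 2 0).imp (Def.eq 1 0)))))).and
  (Def.allMem hH k (P := fun α v => ∃ ξ ∈ v j, ∃ η ∈ v k,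
      ZFSet.pair ξ η ∈ v i ∧ (α ∈ η ∨ α = η))
    (Def.exMem hH j.succ (P := fun ξ v => ∃ η ∈ v k.succ,
      ZFSet.pair ξ η ∈ v i.succ ∧ (v 0 ∈ η ∨ v 0 = η))
    (Def.exMem hH k.succ.succ (P := fun η v =>
      ZFSet.pair (v 0) η ∈ v i.succ.succ ∧ (v 1 ∈ η ∨ v 1 = η))
    ((Def.rel hH i.succ.succ.succ 1 0).and ((Def.mem 2 0).or (Def.eq 2 0))))))

theorem Def.separatingRel (hH : ∀ y ∈ H, ∀ x ∈ y, x ∈ H) (i j k : Fin n) :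
    Def H (fun v => SeparatingRel (v i) (v j) (v k)) :=
  Def.allMem hH j (P := fun a v => ∀ b ∈ v j,
      (∀ ξ ∈ v k, ZFSet.pair a ξ ∈ v i ↔ ZFSet.pair b ξ ∈ v i) → a = b)
    (Def.allMem hH j.succ (P := fun b v =>
      (∀ ξ ∈ v k.succ, ZFSet.pair (v 0) ξ ∈ v i.succ ↔ ZFSet.pair b ξ ∈ v i.succ) → v 0 = b)
    ((Def.allMem hH k.succ.succ (P := fun ξ v =>
      ZFSet.pair (v 1) ξ ∈ v i.succ.succ ↔ ZFSet.pair (v 0) ξ ∈ v i.succ.succ)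
    ((Def.rel hH i.succ.succ.succ 2 0).iff (Def.rel hH i.succ.succ.succ 1 0))).imp (Def.eq 1 0)))

theorem Def.codesPowerset (hH : ∀ y ∈ H, ∀ x ∈ y, x ∈ H) (i j k : Fin n) :
    Def H (fun v => CodesPowerset H (v i) (v j) (v k)) :=
  Def.all (P := fun d v => d ⊆ v k → ∃ δ ∈ v j, ∀ ξ ∈ v k, ξ ∈ d ↔ ZFSet.pair δ ξ ∈ v i)
    ((Def.subset hH 0 k.succ).imp
    (Def.exMem hH j.succ (P := fun δ v =>
      ∀ ξ ∈ v k.succ, ξ ∈ v 0 ↔ ZFSet.pair δ ξ ∈ v i.succ)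
    (Def.allMem hH k.succ.succ (P := fun ξ v =>
      ξ ∈ v 1 ↔ ZFSet.pair (v 0) ξ ∈ v i.succ.succ)
    ((Def.mem 0 2).iff (Def.rel hH i.succ.succ.succ 1 0)))))

theorem Def.injectiveRel (hH : ∀ y ∈ H, ∀ x ∈ y, x ∈ H) (i j k : Fin n) :
    Def H (fun v => InjectiveRel (v i) (v j) (v k)) :=
  (Def.allMem hH j (P := fun δ v => ∃ η ∈ v k, ZFSet.pair δ η ∈ v i)
    (Def.exMem hH k.succ (P := fun η v => ZFSet.pair (v 0) η ∈ v i.succ)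
    (Def.rel hH i.succ.succ 1 0))).and
  (Def.allMem hH j (P := fun δ v => ∀ δ' ∈ v j, ∀ η ∈ v k,
      ZFSet.pair δ η ∈ v i → ZFSet.pair δ' η ∈ v i → δ = δ')
    (Def.allMem hH j.succ (P := fun δ' v => ∀ η ∈ v k.succ,
      ZFSet.pair (v 0) η ∈ v i.succ → ZFSet.pair δ' η ∈ v i.succ → v 0 = δ')
    (Def.allMem hH k.succ.succ (P := fun η v =>
      ZFSet.pair (v 1) η ∈ v i.succ.succ → ZFSet.pair (v 0) η ∈ v i.succ.succ → v 1 = v 0)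
    ((Def.rel hH i.succ.succ.succ 2 0).imp
      ((Def.rel hH i.succ.succ.succ 1 0).imp (Def.eq 2 1))))))

end DefRel

theorem CodesPowerset.two_power_le {θ R γ β : ZFSet} (h : CodesPowerset (HSet θ) R γ β)
    (hβ : β ∈ HSet θ) : (2 : Cardinal) ^ card β ≤ card γ := by
  let d : Set β.toSet → ZFSet := fun s => β.sep fun ξ => ∃ hξ : ξ ∈ β, ⟨ξ, hξ⟩ ∈ s
  have hd : ∀ s, d s ⊆ β := fun s => ZFSet.sep_subset
  choose δ hδ hδd using fun s => h (d s) (HSet.subset hβ (hd s)) (hd s)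
  rw [card, card, ← Cardinal.mk_set]
  refine Cardinal.mk_le_of_injective (f := fun s => (⟨δ s, hδ s⟩ : γ.toSet)) fun s t hst => ?_
  have hst' : δ s = δ t := congrArg Subtype.val hst
  ext ⟨ξ, hξ⟩
  have key : ∀ s, ξ ∈ d s ↔ ⟨ξ, hξ⟩ ∈ s := fun s =>
    ZFSet.mem_sep.trans ⟨fun ⟨_, _, h⟩ => h, fun h => ⟨hξ, hξ, h⟩⟩
  rw [← key, ← key, hδd s ξ hξ, hδd t ξ hξ, hst']

/-! ### The critical ordinal of an elementary substructure -/

section Kappa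

variable {θ κ : ZFSet} {M : Set ZFSet}

theorem KappaSpec.mem_of_mem (hκ : KappaSpec M κ) {α ξ : ZFSet} (hα : α ∈ κ) (hαM : α ∈ M)
    (hξ : ξ ∈ α) : ξ ∈ M := by
  by_contra h
  rcases hκ.2.2.2 α (hκ.1.mem hα) hαM ⟨ξ, hξ, h⟩ with h' | rfl
  · exact ZFSet.mem_asymm hα h'
  · exact ZFSet.mem_irrefl _ hα

theorem KappaSpec.not_cofinal (hθ : ℵ₀ ≤ card θ) (hM : Prec M (HSet θ)) (hκ : KappaSpec M κ)
    {β : ZFSet} (hβ : β ∈ κ) (f : β.toSet → κ.toSet) : ¬ ∀ α ∈ κ, ∃ ξ, ole α (f ξ).1 := by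
  intro hf
  have hκH := hM.1 hκ.2.1
  have hex : ∃ R ∈ HSet θ, CofinalRel R β κ := by
    obtain ⟨R, hR, h⟩ := HSet.exists_rel hθ hκH hκ.1 fun ξ η => ∃ hξ : ξ ∈ β, η = (f ⟨ξ, hξ⟩).1
    have hβκ := hκ.1.1 β hβ
    refine ⟨R, hR, fun ξ hξ η hη η' hη' h₁ h₂ => ?_, fun α hα => ?_⟩
    · obtain ⟨_, rfl⟩ := (h ξ (hβκ hξ) η hη).1 h₁
      obtain ⟨_, rfl⟩ := (h ξ (hβκ hξ) η' hη').1 h₂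
      rfl
    · obtain ⟨⟨ξ, hξ⟩, hle⟩ := hf α hα
      exact ⟨ξ, hξ, _, (f ⟨ξ, hξ⟩).2, (h ξ (hβκ hξ) _ (f ⟨ξ, hξ⟩).2).2 ⟨hξ, rfl⟩, hle⟩
  have hH := HSet.transitive θ
  obtain ⟨β, hβM, hb⟩ := hM.exists_mem ((Def.mem 0 1).and
    (Def.ex (P := fun R v => CofinalRel R (v 0) (v 1)) (Def.cofinalRel hH 0 1 2)))
    ![κ] (by simpa using hκ.2.1) ⟨β, HSet.mem hκH hβ, hβ, hex⟩
  obtain ⟨hβκ, hR⟩ : β ∈ κ ∧ ∃ R ∈ HSet θ, CofinalRel R β κ := hb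
  obtain ⟨R, hRM, hRc⟩ := hM.exists_mem (Def.cofinalRel hH 0 1 2)
    ![β, κ] (by simp [Fin.forall_fin_two, hβM, hκ.2.1]) hR
  obtain ⟨hfun, hcof⟩ : CofinalRel R β κ := hRc
  obtain ⟨α, hα, hαM⟩ := hκ.2.2.1
  obtain ⟨ξ, hξ, η, hη, hRη, hle⟩ := hcof α hα
  have hξM := hκ.mem_of_mem hβκ hβM hξ
  obtain ⟨η', hη'M, h⟩ := hM.exists_mem ((Def.mem 0 1).and (Def.rel hH 3 2 0))
    ![κ, ξ, R] (by simp [Fin.forall_fin_succ, hκ.2.1, hξM, hRM])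
    ⟨η, HSet.mem hκH hη, hη, hRη⟩
  obtain ⟨hη'κ, hRη'⟩ : η' ∈ κ ∧ ZFSet.pair ξ η' ∈ R := h
  obtain rfl := hfun ξ hξ η hη η' hη'κ hRη hRη'
  rcases hle with hle | rfl
  · exact hαM (hκ.mem_of_mem hη hη'M hle)
  · exact hαM hη'M

theorem KappaSpec.omega_mem (hθ : ℵ₀ ≤ card θ) (hM : Prec M (HSet θ)) (hκ : KappaSpec M κ) :
    ZFSet.omega ∈ κ ∧ ZFSet.omega ∈ M := by
  obtain ⟨α, hα, hαM⟩ := hκ.2.2.1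
  have hsub : ZFSet.omega ⊆ κ := by
    refine (hκ.1.isOrdinal.notMem_iff_subset isOrd_omega.isOrdinal).1 fun h => ?_
    exact hαM (omega_subset hθ hM (isOrd_omega.1 κ h hα))
  have hω := GuessingModels.omega_mem hM (HSet.subset (hM.1 hκ.2.1) hsub)
  rcases (isOrd_omega.isOrdinal.subset_iff_eq_or_mem hκ.1.isOrdinal).1 hsub with h | h
  · exact (hαM (omega_subset hθ hM (h ▸ hα))).elim
  · exact ⟨h, hω⟩

theorem KappaSpec.isRegCard (hθ : ℵ₀ ≤ card θ) (hM : Prec M (HSet θ)) (hκ : KappaSpec M κ) :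
    IsRegCard κ := by
  refine ⟨⟨hκ.1, fun β hβ => ?_⟩, hκ.1.1 _ (hκ.omega_mem hθ hM).1, fun s hs => ?_⟩
  · by_contra! h
    obtain ⟨g⟩ := h
    have : Nonempty κ.toSet := ⟨⟨β, hβ⟩⟩
    refine hκ.not_cofinal hθ hM hβ (Function.invFun g) fun α hα => ?_
    obtain ⟨ξ, hξ⟩ := Function.invFun_surjective g.injective ⟨α, hα⟩
    exact ⟨ξ, Or.inr (congrArg Subtype.val hξ).symm⟩
  · refine (Cardinal.mk_le_mk_of_subset hs.1).antisymm (le_of_not_gt fun hlt => ?_)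
    obtain ⟨β, hβ, hβs⟩ := hκ.1.exists_card_eq hlt
    obtain ⟨e⟩ := Cardinal.eq.1 hβs
    refine hκ.not_cofinal hθ hM hβ (fun ξ => ⟨(e ξ).1, hs.1 _ (e ξ).2⟩) fun α hα => ?_
    obtain ⟨γ, hγ, hle⟩ := hs.2 α hα
    exact ⟨e.symm ⟨γ, hγ⟩, by simpa using hle⟩

end Kappa

section Guessing

variable {θ κ : ZFSet.{0}} {M : Set ZFSet.{0}}

theorem KappaSpec.mem_of_subset (hθ : ℵ₀ ≤ card θ) (hM : Prec M (HSet θ)) (hκ : KappaSpec M κ)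
    (hG : GuessingModel M ℵ₀) {β d : ZFSet} (hβ : β ∈ κ) (hβM : β ∈ M) (hd : d ⊆ β) : d ∈ M := by
  obtain ⟨e, he, heβ, h⟩ := hG.guessed hθ hM hβM hd
  have : e = d := ZFSet.ext fun z =>
    ⟨fun hz => (h z (hκ.mem_of_mem hβ hβM (heβ hz))).1 hz,
      fun hz => (h z (hκ.mem_of_mem hβ hβM (hd hz))).2 hz⟩
  exact this ▸ he

theorem KappaSpec.two_power_lt_of_mem (hθ : ℵ₀ ≤ card θ) (hM : Prec M (HSet θ))
    (hκ : KappaSpec M κ) (hG : GuessingModel M ℵ₀) {β : ZFSet} (hβ : β ∈ κ) (hβM : β ∈ M) :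
    (2 : Cardinal) ^ card β < card κ := by
  by_contra! hle
  rw [card, card, ← Cardinal.mk_set] at hle
  obtain ⟨f⟩ := hle
  have hH := HSet.transitive θ
  have hκH := hM.1 hκ.2.1
  have hβκ := hκ.1.1 β hβ
  have hex : ∃ R ∈ HSet θ, SeparatingRel R κ β := by
    obtain ⟨R, hR, h⟩ := HSet.exists_rel hθ hκH hκ.1 fun a ξ =>
      ∃ (ha : a ∈ κ) (hξ : ξ ∈ β), ⟨ξ, hξ⟩ ∈ f ⟨a, ha⟩
    refine ⟨R, hR, fun a ha b hb hab => ?_⟩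
    refine congrArg Subtype.val (f.injective (a₁ := ⟨a, ha⟩) (a₂ := ⟨b, hb⟩) ?_)
    ext ⟨ξ, hξ⟩
    have := hab ξ hξ
    rw [h a ha ξ (hβκ hξ), h b hb ξ (hβκ hξ)] at this
    exact ⟨fun h => (this.1 ⟨ha, hξ, h⟩).2.2, fun h => (this.2 ⟨hb, hξ, h⟩).2.2⟩
  obtain ⟨R, hRM, hR⟩ := hM.exists_mem (Def.separatingRel hH 0 1 2)
    ![κ, β] (by simp [Fin.forall_fin_two, hβM, hκ.2.1]) hex
  replace hR : SeparatingRel R κ β := hR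
  obtain ⟨α, hα, hαM⟩ := hκ.2.2.1
  let d : ZFSet := β.sep fun ξ => ZFSet.pair α ξ ∈ R
  have hdM : d ∈ M := hκ.mem_of_subset hθ hM hG hβ hβM ZFSet.sep_subset
  have hd : ∀ ξ ∈ β, ξ ∈ d ↔ ZFSet.pair α ξ ∈ R := fun ξ hξ =>
    ZFSet.mem_sep.trans (and_iff_right hξ)
  obtain ⟨a, haM, ha⟩ := hM.exists_mem ((Def.mem 0 1).and
    (Def.allMem hH 2 (P := fun ξ v => ξ ∈ v 3 ↔ ZFSet.pair (v 0) ξ ∈ v 4)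
      ((Def.mem 0 4).iff (Def.rel hH 5 1 0))))
    ![κ, β, d, R] (by simp [Fin.forall_fin_succ, hκ.2.1, hβM, hdM, hRM])
    ⟨α, HSet.mem hκH hα, hα, hd⟩
  obtain ⟨haκ, had⟩ : a ∈ κ ∧ ∀ ξ ∈ β, ξ ∈ d ↔ ZFSet.pair a ξ ∈ R := ha
  exact hαM (hR a haκ α hα (fun ξ hξ => (had ξ hξ).symm.trans (hd ξ hξ)) ▸ haM)

theorem KappaSpec.exists_codesPowerset (hθ : ℵ₀ ≤ card θ) (hM : Prec M (HSet θ))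
    (hκ : KappaSpec M κ) (hG : GuessingModel M ℵ₀) {β : ZFSet} (hβ : β ∈ κ) (hβM : β ∈ M) :
    ∃ γ ∈ M, γ ∈ κ ∧ ∃ R ∈ HSet θ, CodesPowerset (HSet θ) R γ β := by
  have hκH := hM.1 hκ.2.1
  have hβκ := hκ.1.1 β hβ
  obtain ⟨γ, hγ, hγc⟩ := hκ.1.exists_card_eq (hκ.two_power_lt_of_mem hθ hM hG hβ hβM)
  rw [card, card, ← Cardinal.mk_set] at hγc
  obtain ⟨e⟩ := Cardinal.eq.1 hγc
  have hex : ∃ R ∈ HSet θ, CodesPowerset (HSet θ) R γ β := by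
    obtain ⟨R, hR, h⟩ := HSet.exists_rel hθ hκH hκ.1 fun δ ξ =>
      ∃ (hδ : δ ∈ γ) (hξ : ξ ∈ β), ⟨ξ, hξ⟩ ∈ e ⟨δ, hδ⟩
    refine ⟨R, hR, fun d _ _ => ?_⟩
    let δ := e.symm {ξ | ξ.1 ∈ d}
    have hδ : e δ = {ξ | ξ.1 ∈ d} := e.apply_symm_apply _
    refine ⟨δ.1, δ.2, fun ξ hξ => ?_⟩
    rw [h δ.1 (hκ.1.1 γ hγ δ.2) ξ (hβκ hξ)]
    change _ ↔ ∃ (_ : δ.1 ∈ γ) (hξ : ξ ∈ β), ⟨ξ, hξ⟩ ∈ e δ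
    rw [hδ]
    exact ⟨fun h => ⟨δ.2, hξ, h⟩, fun h => h.2.2⟩
  exact hM.exists_mem ((Def.mem 0 1).and
    (Def.ex (P := fun R v => CodesPowerset (HSet θ) R (v 0) (v 2))
      (Def.codesPowerset (HSet.transitive θ) 0 1 3)))
    ![κ, β] (by simp [Fin.forall_fin_two, hβM, hκ.2.1]) ⟨γ, HSet.mem hκH hγ, hγ, hex⟩

theorem KappaSpec.exists_two_power_le (hθ : ℵ₀ ≤ card θ) (hM : Prec M (HSet θ))
    (hκ : KappaSpec M κ) (hG : GuessingModel M ℵ₀) {β : ZFSet} (hβ : β ∈ κ) (hβM : β ∈ M) :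
    ∃ γ ∈ M, γ ∈ κ ∧ (2 : Cardinal) ^ card β ≤ card γ := by
  obtain ⟨γ, hγM, hγ, R, _, h⟩ := hκ.exists_codesPowerset hθ hM hG hβ hβM
  exact ⟨γ, hγM, hγ, h.two_power_le (hM.1 hβM)⟩

theorem KappaSpec.isInacc (hθ : ℵ₀ ≤ card θ) (hM : Prec M (HSet θ)) (hκ : KappaSpec M κ)
    (hG : GuessingModel M ℵ₀) : IsInacc κ := by
  have hκH := hM.1 hκ.2.1
  have hreg := hκ.isRegCard hθ hM
  refine ⟨hreg, (hκ.omega_mem hθ hM).1, fun β hβ => ?_⟩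
  by_cases h : ∃ γ ∈ κ, ∃ R ∈ HSet θ, CodesPowerset (HSet θ) R γ β
  · obtain ⟨γ, hγ, R, _, hR⟩ := h
    exact (hR.two_power_le (HSet.mem hκH hβ)).trans_lt (hreg.1.2 γ hγ)
  · obtain ⟨β', hβ'M, hβ'⟩ := hM.exists_mem ((Def.mem 0 1).and
      (Def.exMem (HSet.transitive θ) 1
        (P := fun γ v => ∃ R ∈ HSet θ, CodesPowerset (HSet θ) R γ (v 0))
        (Def.ex (P := fun R v => CodesPowerset (HSet θ) R (v 0) (v 1))
          (Def.codesPowerset (HSet.transitive θ) 0 1 2))).not)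
      ![κ] (by simpa using hκ.2.1) ⟨β, HSet.mem hκH hβ, hβ, h⟩
    obtain ⟨hβ'κ, hnot⟩ :
      β' ∈ κ ∧ ¬ ∃ γ ∈ κ, ∃ R ∈ HSet θ, CodesPowerset (HSet θ) R γ β' := hβ'
    obtain ⟨γ, _, h⟩ := hκ.exists_codesPowerset hθ hM hG hβ'κ hβ'M
    exact (hnot ⟨γ, h⟩).elim

theorem KappaSpec.mk_eq_of_cofinal (hθ : ℵ₀ ≤ card θ) (hM : Prec M (HSet θ))
    (hκ : KappaSpec M κ) (hG : GuessingModel M ℵ₀) {μ : ZFSet} (hμ : ∀ x, x ∈ μ ↔ x ∈ κ ∧ x ∈ M)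
    (hμord : IsOrd μ) {s : Set ZFSet} (hs : CofinalSetIn s μ) : Cardinal.mk s = card μ := by
  refine (Cardinal.mk_le_mk_of_subset hs.1).antisymm (le_of_not_gt fun hlt => ?_)
  have hH := HSet.transitive θ
  have hκH := hM.1 hκ.2.1
  obtain ⟨ν, hν, hνs⟩ := hμord.exists_card_eq hlt
  obtain ⟨γ, hγM, hγ, hγle⟩ :=
    hκ.exists_two_power_le hθ hM hG ((hμ ν).1 hν).1 ((hμ ν).1 hν).2
  obtain ⟨e, heM, heκ, he⟩ := hG.guessed hθ hM hκ.2.1 (d := κ.sep (· ∈ s)) ZFSet.sep_subset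
  replace he : ∀ z ∈ M, z ∈ e ↔ z ∈ s := fun z hz => (he z hz).trans <|
    ZFSet.mem_sep.trans (and_iff_right_of_imp fun h => ((hμ z).1 (hs.1 z h)).1)
  have hcof : CofinalSetIn e.toSet κ := by
    refine ⟨fun x hx => heκ hx, ?_⟩
    by_contra! hnot
    obtain ⟨α, hα, hαe⟩ := hnot
    obtain ⟨α', hα'M, h⟩ := hM.exists_mem ((Def.mem 0 1).and
      (Def.allMem hH 2 (P := fun η v => ¬ (v 0 ∈ η ∨ v 0 = η))
        ((Def.mem 1 0).or (Def.eq 1 0)).not))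
      ![κ, e] (by simp [Fin.forall_fin_two, heM, hκ.2.1]) ⟨α, HSet.mem hκH hα, hα, hαe⟩
    obtain ⟨hα'κ, hα'e⟩ : α' ∈ κ ∧ ∀ η ∈ e, ¬ ole α' η := h
    obtain ⟨η, hη, hle⟩ := hs.2 α' ((hμ _).2 ⟨hα'κ, hα'M⟩)
    exact hα'e η ((he η ((hμ η).1 (hs.1 η hη)).2).2 hη) hle
  have hreg := hκ.isRegCard hθ hM
  have hγe : card γ ≤ card e := (hreg.1.2 γ hγ).le.trans_eq (hreg.2.2 _ hcof).symm
  obtain ⟨f⟩ := hγe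
  have hex : ∃ R ∈ HSet θ, InjectiveRel R γ e := by
    obtain ⟨R, hR, h⟩ := HSet.exists_rel hθ hκH hκ.1 fun δ η => ∃ hδ : δ ∈ γ, η = (f ⟨δ, hδ⟩).1
    have hγκ := hκ.1.1 γ hγ
    refine ⟨R, hR, fun δ hδ => ⟨_, (f ⟨δ, hδ⟩).2, ?_⟩, fun δ hδ δ' hδ' η hη h₁ h₂ => ?_⟩
    · exact (h δ (hγκ hδ) _ (heκ (f ⟨δ, hδ⟩).2)).2 ⟨hδ, rfl⟩
    · obtain ⟨_, h₃⟩ := (h δ (hγκ hδ) η (heκ hη)).1 h₁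
      obtain ⟨_, h₄⟩ := (h δ' (hγκ hδ') η (heκ hη)).1 h₂
      exact congrArg Subtype.val (f.injective (Subtype.ext (h₃.symm.trans h₄)))
  obtain ⟨R, hRM, hR⟩ := hM.exists_mem (Def.injectiveRel hH 0 1 2)
    ![γ, e] (by simp [Fin.forall_fin_two, hγM, heM]) hex
  obtain ⟨htot, hinj⟩ : InjectiveRel R γ e := hR
  have hval : ∀ δ : γ.toSet, ∃ η : s, η.1 ∈ e ∧ ZFSet.pair δ.1 η.1 ∈ R := by
    rintro ⟨δ, hδ⟩
    obtain ⟨η, hη, hRη⟩ := htot δ hδ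
    have hδM := hκ.mem_of_mem hγ hγM hδ
    obtain ⟨η', hη'M, h⟩ := hM.exists_mem ((Def.mem 0 1).and (Def.rel hH 3 2 0))
      ![e, δ, R] (by simp [Fin.forall_fin_succ, heM, hδM, hRM])
      ⟨η, HSet.mem (hM.1 heM) hη, hη, hRη⟩
    obtain ⟨hη'e, hRη'⟩ : η' ∈ e ∧ ZFSet.pair δ η' ∈ R := h
    exact ⟨⟨η', (he η' hη'M).1 hη'e⟩, hη'e, hRη'⟩
  choose g hge hgR using hval
  have hle : card γ ≤ Cardinal.mk s := Cardinal.mk_le_of_injective (f := g) fun δ δ' h =>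
    Subtype.ext (hinj _ δ.2 _ δ'.2 _ (hge δ) (hgR δ) (h ▸ hgR δ'))
  rw [← hνs] at hle
  exact ((Cardinal.cantor _).trans_le hγle).not_ge hle

end Guessing

/-- Proposition 2.2(5): if `M ≺ H_θ` is an `ℵ₀`-guessing model then both `κ_M`
and `M ∩ κ_M` are strongly inaccessible cardinals. -/
theorem kappaM_inaccessible (θ : ZFSet) (hθ : IsRegCard θ)
    (M : Set ZFSet) (hM : Prec M (HSet θ)) (κ : ZFSet) (hκ : KappaSpec M κ)
    (hG : GuessingModel M ℵ₀) :
    IsInacc κ ∧ ∃ μ : ZFSet, IsInacc μ ∧ μ.toSet = M ∩ κ.toSet := by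
  have hθ₀ := aleph0_le_card hθ.2.1
  let μ : ZFSet := κ.sep (· ∈ M)
  have hμ : ∀ x, x ∈ μ ↔ x ∈ κ ∧ x ∈ M := fun x => ZFSet.mem_sep
  have hμord : IsOrd μ := by
    refine ⟨fun y hy z hz => ?_, fun y hy => hκ.1.2 y ((hμ y).1 hy).1⟩
    obtain ⟨hyκ, hyM⟩ := (hμ y).1 hy
    exact (hμ z).2 ⟨hκ.1.1 y hyκ hz, hκ.mem_of_mem hyκ hyM hz⟩
  have hpow : ∀ β ∈ μ, ∃ γ ∈ μ, (2 : Cardinal) ^ card β ≤ card γ := by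
    intro β hβ
    obtain ⟨γ, hγM, hγ, h⟩ :=
      hκ.exists_two_power_le hθ₀ hM hG ((hμ β).1 hβ).1 ((hμ β).1 hβ).2
    exact ⟨γ, (hμ γ).2 ⟨hγ, hγM⟩, h⟩
  have hcard : ∀ β ∈ μ, card β < card μ := by
    intro β hβ
    obtain ⟨γ, hγ, h⟩ := hpow β hβ
    exact ((Cardinal.cantor _).trans_le h).trans_le (card_mono (hμord.1 γ hγ))
  have hω : ZFSet.omega ∈ μ := (hμ _).2 (hκ.omega_mem hθ₀ hM)
  refine ⟨hκ.isInacc hθ₀ hM hG, μ,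
    ⟨⟨⟨hμord, hcard⟩, hμord.1 _ hω, fun s hs => hκ.mk_eq_of_cofinal hθ₀ hM hG hμ hμord hs⟩, hω,
      fun β hβ => ?_⟩, ?_⟩
  · obtain ⟨γ, hγ, h⟩ := hpow β hβ
    exact h.trans_lt (hcard γ hγ)
  · ext x
    exact (hμ x).trans and_comm

end GuessingModels
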